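/- Let k be an algebraically closed field of characteristic 0 and let F ∈ k[x,y,z] be a squarefree homogeneous polynomial of degree d ≥ 1 which factors into r irreducible factors (necessarily pairwise non-associate). Then the number of singular points of the plane curve F, i.e., the number of points P ∈ P^2 at which all three partial derivatives ∂F/∂x, ∂F/∂y, ∂F/∂z vanish, is at most binom(d−1, 2) + (r − 1). In particular, a reduced plane curve of degree d has at most binom(d, 2) singular points. -/

import Mathlib

open MvPolynomial

namespace MvPolynomial

theorem finrank_homogeneousSubmodule_fin_three (k : Type*) [Field k] (n : ℕ) :
    Module.finrank k (homogeneousSubmodule (Fin 3) k n) = (n + 2).choose 2 := by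
  have h : homogeneousSubmodule (Fin 3) k n = restrictSupport k {d | d.degree = n} :=
    homogeneousSubmodule_eq_finsupp_supported _ _ _
  have hset : {d : Fin 3 →₀ ℕ | d.degree = n} =
      (Finset.univ.finsuppAntidiag n : Finset (Fin 3 →₀ ℕ)) := by
    ext d
    simp [Finset.mem_finsuppAntidiag, Finsupp.degree_eq_sum]
  rw [h, Module.finrank_eq_nat_card_basis (basisRestrictSupport k _), hset, Nat.card_coe_set_eq,
    Set.ncard_coe_finset, Finset.card_finsuppAntidiag_nat_eq_choose, Finset.card_univ,
    Fintype.card_fin, show 3 + n - 1 = n + 2 by omega]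
  exact Nat.choose_symm_add

instance finiteDimensional_homogeneousSubmodule (k : Type*) [Field k] (n : ℕ) :
    FiniteDimensional k (homogeneousSubmodule (Fin 3) k n) :=
  Module.Finite.iff_fg.2 (homogeneousSubmodule_fg _ _ n)

/-- The algebra map recording the grading: it sends `p` to `∑ pₙ Tⁿ`, where `pₙ` is the
homogeneous component of degree `n`. -/
noncomputable def gradingHom (σ R : Type*) [CommRing R] :
    MvPolynomial σ R →ₐ[R] Polynomial (MvPolynomial σ R) :=
  aeval fun i => Polynomial.C (X i) * Polynomial.X

theorem gradingHom_monomial {σ R : Type*} [CommRing R] (s : σ →₀ ℕ) (a : R) :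
    gradingHom σ R (monomial s a) = Polynomial.C (monomial s a) * Polynomial.X ^ s.degree := by
  rw [gradingHom, aeval_monomial, monomial_eq (s := s) (a := a)]
  simp only [Finsupp.prod, mul_pow, Finset.prod_mul_distrib, Finset.prod_pow_eq_pow_sum, map_mul,
    map_prod, map_pow, Finsupp.degree, mul_assoc]
  rfl

theorem coeff_gradingHom {σ R : Type*} [CommRing R] (p : MvPolynomial σ R) (n : ℕ) :
    (gradingHom σ R p).coeff n = homogeneousComponent n p := by
  induction p using MvPolynomial.induction_on' with
  | monomial s a =>
    rw [gradingHom_monomial, Polynomial.coeff_C_mul_X_pow,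
      homogeneousComponent_of_mem (n := s.degree) (isHomogeneous_monomial a rfl)]
  | add p q hp hq => simp [hp, hq]

theorem gradingHom_of_isHomogeneous {σ R : Type*} [CommRing R] {p : MvPolynomial σ R} {n : ℕ}
    (hp : p.IsHomogeneous n) : gradingHom σ R p = Polynomial.C p * Polynomial.X ^ n := by
  ext1 m
  rw [coeff_gradingHom, Polynomial.coeff_C_mul_X_pow, homogeneousComponent_of_mem hp]

theorem gradingHom_ne_zero {σ R : Type*} [CommRing R] {p : MvPolynomial σ R} (hp : p ≠ 0) :
    gradingHom σ R p ≠ 0 := by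
  intro h
  apply hp
  rw [← sum_homogeneousComponent p]
  simp [← coeff_gradingHom, h]

theorem isHomogeneous_of_natTrailingDegree {σ R : Type*} [CommRing R] {p : MvPolynomial σ R}
    (h : (gradingHom σ R p).natDegree ≤ (gradingHom σ R p).natTrailingDegree) :
    p.IsHomogeneous (gradingHom σ R p).natDegree := by
  have key (n : ℕ) (hn : n ≠ (gradingHom σ R p).natDegree) : homogeneousComponent n p = 0 := by
    rw [← coeff_gradingHom]
    rcases lt_or_gt_of_ne hn with hn | hn
    · exact Polynomial.coeff_eq_zero_of_lt_natTrailingDegree (hn.trans_le h)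
    · exact Polynomial.coeff_eq_zero_of_natDegree_lt hn
  have : p = homogeneousComponent (gradingHom σ R p).natDegree p := by
    conv_lhs => rw [← sum_homogeneousComponent p]
    rw [Finset.sum_eq_single (gradingHom σ R p).natDegree]
    · exact fun n _ hn => key n hn
    · intro hn
      exact homogeneousComponent_eq_zero _ _ (by simpa using hn)
  rw [this]
  convert! homogeneousComponent_isHomogeneous _ p
  rw [← this]

theorem IsHomogeneous.exists_of_mul {σ R : Type*} [CommRing R] [IsDomain R]
    {p q : MvPolynomial σ R} {n : ℕ} (h : (p * q).IsHomogeneous n) (h0 : p * q ≠ 0) :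
    ∃ a b, a + b = n ∧ p.IsHomogeneous a ∧ q.IsHomogeneous b := by
  have hp := gradingHom_ne_zero (left_ne_zero_of_mul h0)
  have hq := gradingHom_ne_zero (right_ne_zero_of_mul h0)
  have h1 := gradingHom_of_isHomogeneous h
  have hC : (Polynomial.C (p * q)) ≠ 0 := by simpa using h0
  rw [map_mul] at h1
  have hd := congrArg Polynomial.natDegree h1
  have ht := congrArg Polynomial.natTrailingDegree h1
  rw [Polynomial.natDegree_mul hp hq, Polynomial.natDegree_C_mul_X_pow _ _ h0] at hd
  rw [Polynomial.natTrailingDegree_mul hp hq, Polynomial.C_mul_X_pow_eq_monomial,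
    Polynomial.natTrailingDegree_monomial h0] at ht
  have h2 := (gradingHom σ R p).natTrailingDegree_le_natDegree
  have h3 := (gradingHom σ R q).natTrailingDegree_le_natDegree
  exact ⟨_, _, hd, isHomogeneous_of_natTrailingDegree (by omega),
    isHomogeneous_of_natTrailingDegree (by omega)⟩

theorem IsHomogeneous.eval_smul {σ R : Type*} [CommRing R] {p : MvPolynomial σ R} {n : ℕ}
    (hp : p.IsHomogeneous n) (c : R) (x : σ → R) : eval (c • x) p = c ^ n * eval x p := by
  rw [eval_eq, eval_eq, Finset.mul_sum]
  refine Finset.sum_congr rfl fun s hs => ?_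
  have : n = s.degree := by
    by_contra hne
    exact mem_support_iff.1 hs (hp.coeff_eq_zero (Ne.symm hne))
  rw [this, Finsupp.degree_apply, ← Finset.prod_pow_eq_pow_sum]
  simp only [Pi.smul_apply, smul_eq_mul, mul_pow, Finset.prod_mul_distrib]
  ring

/-- The linear form attached to a linear functional on `k^σ`. -/
noncomputable def linearForm {σ k : Type*} [Fintype σ] [DecidableEq σ] [CommRing k]
    (f : (σ → k) →ₗ[k] k) :
    MvPolynomial σ k := ∑ i, C (f (Pi.single i 1)) * X i

section DirectionalDerivative

variable {σ k : Type*} [Fintype σ] [CommRing k]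

theorem isHomogeneous_linearForm [DecidableEq σ] (f : (σ → k) →ₗ[k] k) :
    (linearForm f).IsHomogeneous 1 :=
  IsHomogeneous.sum _ _ _ fun _ _ => isHomogeneous_C_mul_X _ _

theorem sum_mul_apply_single [DecidableEq σ] (f : (σ → k) →ₗ[k] k) (x : σ → k) :
    ∑ i, f (Pi.single i 1) * x i = f x := by
  conv_rhs => rw [pi_eq_sum_univ' x, map_sum]
  simp [mul_comm]

theorem eval_linearForm [DecidableEq σ] (f : (σ → k) →ₗ[k] k) (x : σ → k) :
    eval x (linearForm f) = f x := by
  simpa [linearForm] using sum_mul_apply_single f x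

/-- The directional derivative along `v`. -/
noncomputable def dirDeriv (v : σ → k) : Derivation k (MvPolynomial σ k) (MvPolynomial σ k) :=
  ∑ i, v i • pderiv i

theorem eval_dirDeriv (v x : σ → k) (p : MvPolynomial σ k) :
    eval x (dirDeriv v p) = ∑ i, v i * eval x (pderiv i p) := by
  have : dirDeriv v p = ∑ i, v i • pderiv i p := by
    have := congrFun (map_sum (Derivation.coeFnAddMonoidHom (R := k)
      (A := MvPolynomial σ k) (M := MvPolynomial σ k)) (fun i => v i • pderiv i) Finset.univ) p
    rw [Finset.sum_apply] at this
    exact this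
  simp [this, smul_eval]

theorem eval_dirDeriv_linearForm [DecidableEq σ] (f : (σ → k) →ₗ[k] k) (v x : σ → k) :
    eval x (dirDeriv v (linearForm f)) = f v := by
  simp only [eval_dirDeriv, linearForm, map_sum, pderiv_C_mul, pderiv_X]
  rw [← sum_mul_apply_single f v]
  refine Finset.sum_congr rfl fun i _ => ?_
  rw [Finset.sum_eq_single i]
  · simp [mul_comm]
  · intro j _ hj; simp [hj.symm]
  · simp

theorem eval_dirDeriv_mul (v x : σ → k) (p q : MvPolynomial σ k) :
    eval x (dirDeriv v (p * q)) =
      eval x p * eval x (dirDeriv v q) + eval x q * eval x (dirDeriv v p) := by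
  rw [Derivation.leibniz]; simp

end DirectionalDerivative

open scoped LinearAlgebra.Projectivization

section Bezout

variable {k : Type*} [Field k]

theorem rep_notMem_span_rep {V : Type*} [AddCommGroup V] [Module k V] {P Q : ℙ k V}
    (h : P ≠ Q) : P.rep ∉ Submodule.span k {Q.rep} := by
  rw [Submodule.mem_span_singleton]
  intro h'
  rw [← Projectivization.mk_eq_mk_iff' k _ _ P.rep_nonzero Q.rep_nonzero, P.mk_rep, Q.mk_rep] at h'
  exact h h'

theorem exists_form_double_zeros (T : Finset (ℙ k (Fin 3 → k))) {P : ℙ k (Fin 3 → k)}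
    (hP : P ∈ T) :
    ∃ A : MvPolynomial (Fin 3) k, A.IsHomogeneous (2 * (T.card - 1)) ∧ eval P.rep A ≠ 0 ∧
      ∀ Q ∈ T, Q ≠ P → eval Q.rep A = 0 ∧ ∀ v, eval Q.rep (dirDeriv v A) = 0 := by
  classical
  have hf : ∀ Q : ℙ k (Fin 3 → k), ∃ f : (Fin 3 → k) →ₗ[k] k,
      Q ≠ P → f P.rep ≠ 0 ∧ f Q.rep = 0 := by
    intro Q
    by_cases h : Q = P
    · exact ⟨0, fun h' => absurd h h'⟩
    · obtain ⟨f, hf, hf'⟩ := Submodule.exists_le_ker_of_notMem (rep_notMem_span_rep (Ne.symm h))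
      exact ⟨f, fun _ => ⟨hf, hf' (Submodule.mem_span_singleton_self _)⟩⟩
  choose f hf using hf
  refine ⟨∏ Q ∈ T.erase P, linearForm (f Q) ^ 2, ?_, ?_, ?_⟩
  · have := IsHomogeneous.prod (T.erase P) (fun Q => linearForm (f Q) ^ 2) (fun _ => 1 * 2)
      fun Q _ => (isHomogeneous_linearForm (f Q)).pow 2
    rw [Finset.sum_const, Finset.card_erase_of_mem hP] at this
    rwa [smul_eq_mul, one_mul, mul_comm] at this
  · rw [map_prod, Finset.prod_ne_zero_iff]
    intro Q hQ
    rw [map_pow, eval_linearForm]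
    exact pow_ne_zero _ (hf Q (Finset.ne_of_mem_erase hQ)).1
  · intro Q hQ hne
    have h0 := (hf Q hne).2
    rw [← Finset.mul_prod_erase _ _ (Finset.mem_erase.2 ⟨hne, hQ⟩), sq, mul_assoc]
    simp [eval_linearForm, h0]

theorem exists_form_single_jet (T : Finset (ℙ k (Fin 3 → k))) {P : ℙ k (Fin 3 → k)}
    (hP : P ∈ T) {n : ℕ} (hn : 2 * T.card ≤ n) {v : Fin 3 → k}
    (hv : v ∉ Submodule.span k {P.rep}) (a b : k) :
    ∃ H : MvPolynomial (Fin 3) k, H.IsHomogeneous n ∧ eval P.rep H = a ∧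
      eval P.rep (dirDeriv v H) = b ∧
      ∀ Q ∈ T, Q ≠ P → eval Q.rep H = 0 ∧ ∀ w, eval Q.rep (dirDeriv w H) = 0 := by
  obtain ⟨A, hA, hAP, hAQ⟩ := exists_form_double_zeros T hP
  obtain ⟨l, hlv, hlP⟩ := Submodule.exists_le_ker_of_notMem hv
  replace hlP : l P.rep = 0 := hlP (Submodule.mem_span_singleton_self _)
  obtain ⟨m, hmP, -⟩ := Submodule.exists_le_ker_of_notMem (K := k) (p := ⊥) (v := P.rep)
    (by simpa using P.rep_nonzero)
  have hT : 1 ≤ T.card := Finset.card_pos.2 ⟨P, hP⟩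
  obtain ⟨t, rfl⟩ : ∃ t, n = 2 * (T.card - 1) + (1 + t) :=
    ⟨n - (2 * (T.card - 1) + 1), by omega⟩
  have hM : (linearForm m ^ t).IsHomogeneous t := by
    simpa using (isHomogeneous_linearForm m).pow t
  have hgen (c₁ c₂ : k) : (A * ((C c₁ * linearForm m + C c₂ * linearForm l) *
      linearForm m ^ t)).IsHomogeneous (2 * (T.card - 1) + (1 + t)) :=
    hA.mul ((((isHomogeneous_linearForm m).C_mul c₁).add
      ((isHomogeneous_linearForm l).C_mul c₂)).mul hM)
  have hmt := pow_ne_zero t hmP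
  set c₁ := a / (eval P.rep A * (m P.rep * m P.rep ^ t)) with hc₁
  have hval (c₂ : k) : eval P.rep (A * ((C c₁ * linearForm m + C c₂ * linearForm l) *
      linearForm m ^ t)) = a := by
    simp only [map_mul, map_add, map_pow, eval_linearForm, eval_C, hlP, hc₁]
    field_simp
    ring
  refine ⟨_, hgen c₁ ((b - eval P.rep (dirDeriv v (A * (C c₁ * linearForm m * linearForm m ^ t)))) /
    (eval P.rep A * l v * m P.rep ^ t)), hval _, ?_, fun Q hQ hne => ?_⟩
  · set e := eval P.rep (dirDeriv v (A * (C c₁ * linearForm m * linearForm m ^ t))) with he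
    set c₂ := (b - e) / (eval P.rep A * l v * m P.rep ^ t) with hc₂
    have hsplit : A * ((C c₁ * linearForm m + C c₂ * linearForm l) * linearForm m ^ t) =
        A * (C c₁ * linearForm m * linearForm m ^ t) +
          c₂ • (linearForm l * (A * linearForm m ^ t)) := by
      rw [smul_eq_C_mul]; ring
    rw [hsplit, map_add, map_add, ← he, Derivation.map_smul, smul_eval, eval_dirDeriv_mul,
      eval_linearForm, eval_dirDeriv_linearForm, hlP, map_mul (eval P.rep),
      map_pow (eval P.rep), eval_linearForm, hc₂]
    field_simp
    ring
  · obtain ⟨h1, h2⟩ := hAQ Q hQ hne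
    exact ⟨by simp [h1], fun w => by rw [eval_dirDeriv_mul, h1, h2]; simp⟩

/-- Values on `T` and derivatives, in prescribed directions, on `S`. -/
noncomputable def jetMap (T S : Finset (ℙ k (Fin 3 → k))) (v : ℙ k (Fin 3 → k) → Fin 3 → k)
    (n : ℕ) : homogeneousSubmodule (Fin 3) k n →ₗ[k] (T → k) × (S → k) :=
  ((LinearMap.pi fun P : T => (aeval (R := k) P.1.rep).toLinearMap).prod
    (LinearMap.pi fun P : S => (aeval (R := k) P.1.rep).toLinearMap ∘ₗ
      (dirDeriv (v P.1)).toLinearMap)) ∘ₗ (homogeneousSubmodule (Fin 3) k n).subtype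

theorem jetMap_fst (T S : Finset (ℙ k (Fin 3 → k))) (v : ℙ k (Fin 3 → k) → Fin 3 → k)
    (n : ℕ) (H : homogeneousSubmodule (Fin 3) k n) (P : T) :
    (jetMap T S v n H).1 P = eval P.1.rep H.1 := by
  simp [jetMap, aeval_eq_eval]

theorem jetMap_snd (T S : Finset (ℙ k (Fin 3 → k))) (v : ℙ k (Fin 3 → k) → Fin 3 → k)
    (n : ℕ) (H : homogeneousSubmodule (Fin 3) k n) (P : S) :
    (jetMap T S v n H).2 P = eval P.1.rep (dirDeriv (v P.1) H.1) := by
  simp [jetMap, aeval_eq_eval]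

theorem jetMap_surjective {T S : Finset (ℙ k (Fin 3 → k))} (hST : S ⊆ T)
    {v : ℙ k (Fin 3 → k) → Fin 3 → k} (hv : ∀ P, v P ∉ Submodule.span k {P.rep})
    {n : ℕ} (hn : 2 * T.card ≤ n) : Function.Surjective (jetMap T S v n) := by
  classical
  rintro ⟨a, b⟩
  choose H hH hHa hHb hHQ using fun P : T => exists_form_single_jet T P.2 hn (hv P.1) (a P)
    (if h : P.1 ∈ S then b ⟨P.1, h⟩ else 0)
  refine ⟨∑ P : T, ⟨H P, hH P⟩, ?_⟩
  refine Prod.ext ?_ ?_ <;> funext P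
  · rw [jetMap_fst, AddSubmonoidClass.coe_finsetSum, map_sum, Finset.sum_eq_single P, hHa]
    · exact fun Q _ hQ => (hHQ Q P.1 P.2 fun h => hQ (Subtype.ext h.symm)).1
    · simp
  · rw [jetMap_snd, AddSubmonoidClass.coe_finsetSum, map_sum, map_sum,
      Finset.sum_eq_single ⟨P.1, hST P.2⟩]
    · exact (hHb ⟨P.1, hST P.2⟩).trans (dif_pos P.2)
    · exact fun Q _ hQ => (hHQ Q P.1 (hST P.2) fun h => hQ (Subtype.ext h.symm)).2 _
    · simp

theorem exists_tangent_direction (G : MvPolynomial (Fin 3) k) (P : ℙ k (Fin 3 → k)) :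
    ∃ v, v ∉ Submodule.span k {P.rep} ∧ eval P.rep (dirDeriv v G) = 0 := by
  let D : (Fin 3 → k) →ₗ[k] k := ∑ i, eval P.rep (pderiv i G) • LinearMap.proj i
  have hD (v) : D v = eval P.rep (dirDeriv v G) := by
    simp [D, eval_dirDeriv, LinearMap.sum_apply, mul_comm]
  by_contra! h
  have hle : LinearMap.ker D ≤ Submodule.span k {P.rep} := by
    intro v hv
    by_contra hv'
    exact h v hv' (by rw [← hD]; exact hv)
  have h1 := Submodule.finrank_mono hle
  rw [finrank_span_singleton P.rep_nonzero] at h1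
  have h2 := D.finrank_range_add_finrank_ker
  have h3 := Submodule.finrank_le (LinearMap.range D)
  simp only [Module.finrank_fin_fun, Module.finrank_self] at h2 h3
  omega

theorem finrank_map_mulLeft {F : MvPolynomial (Fin 3) k} (hF : F ≠ 0) (n : ℕ) :
    Module.finrank k ((homogeneousSubmodule (Fin 3) k n).map (LinearMap.mulLeft k F)) =
      (n + 2).choose 2 := by
  rw [← finrank_homogeneousSubmodule_fin_three k n]
  exact (Submodule.equivMapOfInjective _ (mul_right_injective₀ hF) _).finrank_eq.symm

theorem two_mul_choose_succ_two (n : ℕ) : 2 * (n + 1).choose 2 = (n + 1) * n := by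
  rw [Nat.choose_two_right, Nat.mul_div_cancel' (Nat.even_mul_pred_self _).two_dvd]
  rfl

/-- Weak form of Bézout's theorem, in which singular points of the first curve count twice. -/
theorem card_add_card_le_mul {F G : MvPolynomial (Fin 3) k} {d e : ℕ} (hF : F.IsHomogeneous d)
    (hG : G.IsHomogeneous e) (hF0 : F ≠ 0) (hG0 : G ≠ 0) (hFG : IsRelPrime F G)
    {T S : Finset (ℙ k (Fin 3 → k))} (hST : S ⊆ T)
    (hT : ∀ P ∈ T, eval P.rep F = 0 ∧ eval P.rep G = 0)
    (hS : ∀ P ∈ S, ∀ i, eval P.rep (pderiv i F) = 0) : T.card + S.card ≤ d * e := by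
  choose v hv hvG using exists_tangent_direction G
  set c := 2 * T.card with hc
  set n := d + e + c with hn
  set A := (homogeneousSubmodule (Fin 3) k (e + c)).map (LinearMap.mulLeft k F) with hA
  set B := (homogeneousSubmodule (Fin 3) k (d + c)).map (LinearMap.mulLeft k G) with hB
  have hinf : A ⊓ B ≤ (homogeneousSubmodule (Fin 3) k c).map (LinearMap.mulLeft k (F * G)) := by
    rintro H ⟨⟨p, hp, hpH⟩, ⟨q, hq, hqH⟩⟩
    simp only [LinearMap.mulLeft_apply] at hpH hqH
    by_cases hH0 : H = 0
    · rw [hH0]; exact zero_mem _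
    obtain ⟨w, hw⟩ := hFG.mul_dvd ⟨p, hpH.symm⟩ ⟨q, hqH.symm⟩
    have hHn : H.IsHomogeneous n := by
      rw [← hpH, hn, add_assoc]
      exact hF.mul hp
    refine ⟨w, ?_, hw.symm⟩
    obtain ⟨i, j, hij, hi, hj⟩ := (hw ▸ hHn).exists_of_mul (hw ▸ hH0)
    have := hi.inj_right (hF.mul hG) (mul_ne_zero hF0 hG0)
    have : j = c := by omega
    exact this ▸ hj
  have hsup : A ⊔ B ≤ (LinearMap.ker (jetMap T S v n)).map (Submodule.subtype _) := by
    refine sup_le ?_ ?_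
    · rintro _ ⟨p, hp, rfl⟩
      refine ⟨⟨F * p, by rw [hn, add_assoc]; exact hF.mul hp⟩, ?_, rfl⟩
      refine Prod.ext ?_ ?_ <;> funext P
      · simp [jetMap_fst, (hT P.1 P.2).1]
      · simp [jetMap_snd, (hT P.1 (hST P.2)).1, eval_dirDeriv, hS P.1 P.2]
    · rintro _ ⟨p, hp, rfl⟩
      refine ⟨⟨G * p, by rw [hn, add_comm d, add_assoc]; exact hG.mul hp⟩, ?_, rfl⟩
      refine Prod.ext ?_ ?_ <;> funext P
      · simp [jetMap_fst, (hT P.1 P.2).2]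
      · simp [jetMap_snd, (hT P.1 (hST P.2)).2, hvG]
  have h1 := Submodule.finrank_mono hinf
  have h2 := Submodule.finrank_mono hsup
  have h3 := Submodule.finrank_sup_add_finrank_inf_eq A B
  have h4 := (jetMap T S v n).finrank_range_add_finrank_ker
  rw [LinearMap.range_eq_top.2 (jetMap_surjective hST hv (by omega)), finrank_top,
    finrank_homogeneousSubmodule_fin_three] at h4
  rw [finrank_map_mulLeft (mul_ne_zero hF0 hG0)] at h1
  rw [Submodule.finrank_map_subtype_eq] at h2
  rw [hA, hB, finrank_map_mulLeft hF0, finrank_map_mulLeft hG0, ← hA, ← hB] at h3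
  simp only [Module.finrank_prod, Module.finrank_fintype_fun_eq_card, Fintype.card_coe] at h4
  have e1 : 2 * (c + 2).choose 2 = (c + 2) * (c + 1) := two_mul_choose_succ_two (c + 1)
  have e2 : 2 * (e + c + 2).choose 2 = (e + c + 2) * (e + c + 1) := two_mul_choose_succ_two (e + c + 1)
  have e3 : 2 * (d + c + 2).choose 2 = (d + c + 2) * (d + c + 1) := two_mul_choose_succ_two (d + c + 1)
  have e4 : 2 * (n + 2).choose 2 = (n + 2) * (n + 1) := two_mul_choose_succ_two (n + 1)
  rw [hn] at e4
  nlinarith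

end Bezout

section SingularPoints

variable {k : Type*} [Field k]

/-- The points of the projective plane at which all partial derivatives of `F` vanish. -/
def projSing (F : MvPolynomial (Fin 3) k) : Set (ℙ k (Fin 3 → k)) :=
  {Q | ∀ i : Fin 3, eval Q.rep (pderiv i F) = 0}

theorem eval_rep_eq_zero_iff {F : MvPolynomial (Fin 3) k} {d : ℕ} (hF : F.IsHomogeneous d)
    {x : Fin 3 → k} (hx : x ≠ 0) :
    eval (Projectivization.mk k x hx).rep F = 0 ↔ eval x F = 0 := by
  obtain ⟨a, ha⟩ := Projectivization.exists_smul_eq_mk_rep k x hx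
  rw [← ha, Units.smul_def, hF.eval_smul]
  simp

theorem eval_eq_zero_of_mem_projSing [CharZero k] {F : MvPolynomial (Fin 3) k} {d : ℕ}
    (hF : F.IsHomogeneous d) (hd : d ≠ 0) {Q : ℙ k (Fin 3 → k)} (hQ : Q ∈ projSing F) :
    eval Q.rep F = 0 := by
  have h := congrArg (eval Q.rep) hF.sum_X_mul_pderiv
  rw [map_sum, map_nsmul, Finset.sum_eq_zero fun i _ => by rw [map_mul, hQ i, mul_zero]] at h
  simpa [hd] using h.symm

theorem exists_zero_on_line [IsAlgClosed k] {F : MvPolynomial (Fin 3) k} {d : ℕ}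
    (hF : F.IsHomogeneous d) (hd : d ≠ 0) (x y : Fin 3 → k) (hx : eval x F ≠ 0) :
    ∃ s : k, eval (y + s • x) F = 0 := by
  let line (a b : Fin 3 → k) : Polynomial k :=
    aeval (fun i => Polynomial.C (a i) + Polynomial.C (b i) * Polynomial.X) F
  have hline (a b : Fin 3 → k) (u : k) : (line a b).eval u = eval (a + u • b) F := by
    rw [← Polynomial.coe_aeval_eq_eval, comp_aeval_apply, ← aeval_eq_eval]
    congr 2
    ext i
    simp only [map_add, map_mul, Polynomial.aeval_X, Polynomial.aeval_C, Algebra.algebraMap_self_apply,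
      Pi.add_apply, Pi.smul_apply, smul_eq_mul, mul_comm u]
  by_cases hdeg : (line x y).degree = 0
  · have hconst (u : k) : eval (x + u • y) F = eval x F := by
      have h0 := hline x y 0
      have hu := hline x y u
      rw [Polynomial.eq_C_of_degree_eq_zero hdeg, Polynomial.eval_C] at h0 hu
      rw [← hu, h0, zero_smul, add_zero]
    have hpoly : line y x = Polynomial.C (eval x F) * Polynomial.X ^ d := by
      apply Polynomial.eq_of_infinite_eval_eq
      refine (Set.finite_singleton (0 : k)).infinite_compl.mono fun s hs => ?_
      have hs : s ≠ 0 := hs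
      have : y + s • x = s • (x + s⁻¹ • y) := by
        rw [smul_add, smul_smul, mul_inv_cancel₀ hs, one_smul, add_comm]
      change (line y x).eval s = _
      rw [hline, this, hF.eval_smul, hconst]
      rw [Polynomial.eval_mul, Polynomial.eval_C, Polynomial.eval_pow, Polynomial.eval_X, mul_comm]
    exact ⟨0, by rw [← hline, hpoly]; simp [hd]⟩
  · obtain ⟨u, hu⟩ := IsAlgClosed.exists_root _ hdeg
    have hu : eval (x + u • y) F = 0 := by rw [← hline]; exact hu
    have hu0 : u ≠ 0 := by
      rintro rfl
      exact hx (by simpa using hu)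
    refine ⟨u⁻¹, ?_⟩
    have : y + u⁻¹ • x = u⁻¹ • (x + u • y) := by
      rw [smul_add, smul_smul, inv_mul_cancel₀ hu0, one_smul, add_comm]
    rw [this, hF.eval_smul, hu, mul_zero]

theorem infinite_zeros [IsAlgClosed k] {F : MvPolynomial (Fin 3) k} {d : ℕ}
    (hF : F.IsHomogeneous d) (hd : d ≠ 0) (hF0 : F ≠ 0) :
    {Q : ℙ k (Fin 3 → k) | eval Q.rep F = 0}.Infinite := by
  have : Infinite k := IsAlgClosed.instInfinite
  obtain ⟨x, hx⟩ : ∃ x, eval x F ≠ 0 := by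
    by_contra! h
    exact hF0 (hF.eq_zero_of_forall_eval_eq_zero h)
  obtain ⟨i, hi⟩ : ∃ i, x i ≠ 0 := by
    by_contra! h
    apply hx
    have : x = (0 : k) • x := by ext i; simp [h i]
    rw [this, hF.eval_smul]
    simp [hd]
  let y (t : k) : Fin 3 → k := Pi.single (i + 1) 1 + Pi.single (i + 2) t
  choose s hs using fun t => exists_zero_on_line hF hd x (y t) hx
  let f : (Fin 3 → k) → k := fun z => z (i + 1) * x i - z i * x (i + 1)
  let g : (Fin 3 → k) → k := fun z => z (i + 2) * x i - z i * x (i + 2)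
  have h1 : i + 1 ≠ i := by simp
  have h2 : i + 2 ≠ i := by simp
  have h3 : i + 1 ≠ i + 2 := by simp
  have hf (t) : f (y t + s t • x) = x i := by
    simp [f, y, h1.symm, h2.symm, h3]
    ring
  have hg (t) : g (y t + s t • x) = t * x i := by
    simp [g, y, h1.symm, h2.symm, h3.symm]
    ring
  have hne (t) : y t + s t • x ≠ 0 := by
    intro h
    have := hf t
    rw [h] at this
    exact hi (by simpa [f] using this.symm)
  refine Set.infinite_of_injective_forall_mem
    (f := fun t => Projectivization.mk k (y t + s t • x) (hne t)) (fun t t' htt' => ?_)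
    fun t => (eval_rep_eq_zero_iff hF _).2 (hs t)
  obtain ⟨a, ha⟩ := (Projectivization.mk_eq_mk_iff' k _ _ _ _).1 htt'
  have hfa : f (a • (y t' + s t' • x)) = a * f (y t' + s t' • x) := by simp [f]; ring
  have hga : g (a • (y t' + s t' • x)) = a * g (y t' + s t' • x) := by simp [g]; ring
  rw [ha, hf, hf] at hfa
  rw [ha, hg, hg] at hga
  have ha1 : a = 1 := by
    apply mul_right_cancel₀ hi
    rw [← hfa, one_mul]
  rw [ha1, one_mul] at hga
  exact mul_right_cancel₀ hi hga

theorem degree_ne_zero_of_irreducible {F : MvPolynomial (Fin 3) k} {d : ℕ}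
    (hirr : Irreducible F) (hF : F.IsHomogeneous d) : d ≠ 0 := by
  rintro rfl
  rw [← totalDegree_zero_iff_isHomogeneous, totalDegree_eq_zero_iff_eq_C] at hF
  apply hirr.not_isUnit
  rw [hF]
  refine (IsUnit.mk0 _ fun h => hirr.ne_zero ?_).map C
  rw [hF, h, C_0]

theorem exists_form_vanishing (T : Finset (ℙ k (Fin 3 → k))) {n : ℕ}
    (hT : T.card < (n + 2).choose 2) :
    ∃ G : MvPolynomial (Fin 3) k, G.IsHomogeneous n ∧ G ≠ 0 ∧ ∀ P ∈ T, eval P.rep G = 0 := by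
  let f : homogeneousSubmodule (Fin 3) k n →ₗ[k] (T → k) :=
    (LinearMap.pi fun P : T => (aeval (R := k) P.1.rep).toLinearMap) ∘ₗ Submodule.subtype _
  have hker : LinearMap.ker f ≠ ⊥ := by
    apply LinearMap.ker_ne_bot_of_finrank_lt
    rwa [finrank_homogeneousSubmodule_fin_three, Module.finrank_fintype_fun_eq_card,
      Fintype.card_coe]
  obtain ⟨G, hG, hG0⟩ := Submodule.exists_mem_ne_zero_of_ne_bot hker
  refine ⟨G, G.2, fun h => hG0 (Subtype.ext h), fun P hP => ?_⟩
  simpa [f, aeval_eq_eval] using congrFun hG ⟨P, hP⟩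

theorem card_le_of_irreducible [IsAlgClosed k] [CharZero k] {F : MvPolynomial (Fin 3) k} {d : ℕ}
    (hirr : Irreducible F) (hF : F.IsHomogeneous d) {S : Finset (ℙ k (Fin 3 → k))}
    (hS : ↑S ⊆ projSing F) : S.card ≤ (d - 1).choose 2 := by
  classical
  have hd := degree_ne_zero_of_irreducible hirr hF
  obtain ⟨d, rfl⟩ : ∃ e, d = e + 1 := ⟨d - 1, by omega⟩
  obtain rfl | hd1 := eq_or_ne d 0
  · have hempty : S = ∅ := by
      refine Finset.eq_empty_of_forall_notMem fun Q hQ => hirr.ne_zero ?_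
      have hp (i : Fin 3) : pderiv i F = 0 := by
        have h0 := hF.pderiv (i := i)
        rw [← totalDegree_zero_iff_isHomogeneous, totalDegree_eq_zero_iff_eq_C] at h0
        have h1 := hS hQ i
        rw [h0, eval_C] at h1
        rw [h0, h1, C_0]
      simpa [hp] using hF.sum_X_mul_pderiv.symm
    simp [hempty]
  obtain ⟨d, rfl⟩ : ∃ e, d = e + 1 := ⟨d - 1, by omega⟩
  by_contra! hlt
  obtain ⟨S', hS', hcard⟩ := Finset.exists_subset_card_eq (Nat.succ_le_of_lt hlt)
  replace hS : ∀ P ∈ S', P ∈ projSing F := fun P hP => hS (hS' hP)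
  obtain ⟨T', hT', hT'card⟩ := ((infinite_zeros hF hd hirr.ne_zero).sdiff
    S'.finite_toSet).exists_subset_card_eq (2 * d + 1)
  have hdisj : Disjoint S' T' :=
    Finset.disjoint_left.2 fun P hP hP' => (hT' hP').2 hP
  have hTcard := Finset.card_union_of_disjoint hdisj
  have e1 := two_mul_choose_succ_two d
  have e2 : 2 * (d + 1 + 2).choose 2 = (d + 1 + 2) * (d + 1 + 1) :=
    two_mul_choose_succ_two (d + 1 + 1)
  simp only [Nat.add_sub_cancel, Nat.succ_eq_add_one] at hcard
  obtain ⟨G, hG, hG0, hGT⟩ := exists_form_vanishing (S' ∪ T') (n := d + 1) (by nlinarith)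
  have hFG : IsRelPrime F G := by
    rw [hirr.isRelPrime_iff_not_dvd]
    rintro ⟨w, rfl⟩
    obtain ⟨i, j, hij, hi, -⟩ := hG.exists_of_mul hG0
    have := hi.inj_right hF hirr.ne_zero
    omega
  have hbez := card_add_card_le_mul hF hG hirr.ne_zero hG0 hFG
    (S := S') (T := S' ∪ T') Finset.subset_union_left (fun P hP => ⟨?_, hGT P hP⟩) hS
  · nlinarith
  · rcases Finset.mem_union.1 hP with hP | hP
    · exact eval_eq_zero_of_mem_projSing hF hd (hS P hP)
    · exact (hT' hP).1

theorem encard_le_of_forall_finset {α : Type*} {s : Set α} {n : ℕ}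
    (h : ∀ t : Finset α, ↑t ⊆ s → t.card ≤ n) : s.encard ≤ n := by
  by_contra! hlt
  obtain ⟨t, hts, ht⟩ := Set.exists_subset_encard_eq (k := (n + 1 : ℕ)) (s := s)
    (by exact_mod_cast Order.add_one_le_of_lt hlt)
  have hfin := Set.finite_of_encard_eq_coe ht
  have := h hfin.toFinset (by simpa using hts)
  rw [hfin.encard_eq_coe_toFinset_card] at ht
  have : hfin.toFinset.card = n + 1 := by exact_mod_cast ht
  omega

theorem projSing_mul_subset [CharZero k] {F G : MvPolynomial (Fin 3) k} {d e : ℕ}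
    (hF : F.IsHomogeneous d) (hG : G.IsHomogeneous e) (hd : d ≠ 0) :
    projSing (F * G) ⊆ projSing F ∪ projSing G ∪ {Q | eval Q.rep F = 0 ∧ eval Q.rep G = 0} := by
  intro Q hQ
  have h0 := eval_eq_zero_of_mem_projSing (hF.mul hG) (by omega) hQ
  have hder (i) : eval Q.rep F * eval Q.rep (pderiv i G) +
      eval Q.rep G * eval Q.rep (pderiv i F) = 0 := by
    simpa [Derivation.leibniz] using hQ i
  rw [map_mul, mul_eq_zero] at h0
  by_cases hF0 : eval Q.rep F = 0
  · by_cases hG0 : eval Q.rep G = 0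
    · exact Or.inr ⟨hF0, hG0⟩
    · exact Or.inl (Or.inl fun i => by simpa [hF0, hG0] using hder i)
  · have hG0 := h0.resolve_left hF0
    exact Or.inl (Or.inr fun i => by simpa [hF0, hG0] using hder i)

theorem choose_pred_add {a b : ℕ} (ha : a ≠ 0) (hb : b ≠ 0) (r : ℕ) :
    (a - 1).choose 2 + ((b - 1).choose 2 + r) + a * b = (a + b - 1).choose 2 + (r + 1) := by
  obtain ⟨a, rfl⟩ := Nat.exists_eq_succ_of_ne_zero ha
  obtain ⟨b, rfl⟩ := Nat.exists_eq_succ_of_ne_zero hb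
  have h (n : ℕ) : (2 : ℤ) * (n.choose 2 : ℕ) = n * (n - 1) := by
    cases n with
    | zero => simp
    | succ n =>
      push_cast
      rw [add_sub_cancel_right]
      exact_mod_cast two_mul_choose_succ_two n
  have h1 := h a
  have h2 := h b
  have h3 := h (a + b + 1)
  simp only [Nat.succ_eq_add_one, Nat.add_sub_cancel,
    show a + 1 + (b + 1) - 1 = a + b + 1 by omega]
  zify
  push_cast at h3
  linarith

theorem encard_projSing_prod_le [IsAlgClosed k] [CharZero k] {ι : Type*}
    (G : ι → MvPolynomial (Fin 3) k) (hirr : ∀ i, Irreducible (G i)) {s : Finset ι}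
    (hs : s.Nonempty) (hsqf : Squarefree (∏ i ∈ s, G i)) {d : ℕ}
    (hhom : (∏ i ∈ s, G i).IsHomogeneous d) :
    s.card ≤ d ∧ (projSing (∏ i ∈ s, G i)).encard ≤ ((d - 1).choose 2 + (s.card - 1) : ℕ) := by
  induction hs using Finset.Nonempty.cons_induction generalizing d with
  | singleton i =>
    rw [Finset.prod_singleton] at hhom ⊢
    refine ⟨?_, encard_le_of_forall_finset fun t ht => ?_⟩
    · have := degree_ne_zero_of_irreducible (hirr i) hhom
      rw [Finset.card_singleton]
      omega
    · simpa using card_le_of_irreducible (hirr i) hhom ht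
  | cons i s hi hs ih =>
    rw [Finset.prod_cons] at hsqf hhom ⊢
    have hne : G i * ∏ j ∈ s, G j ≠ 0 := hsqf.ne_zero
    obtain ⟨a, b, rfl, ha, hb⟩ := hhom.exists_of_mul hne
    obtain ⟨hrel, -, hsqf'⟩ := squarefree_mul_iff.1 hsqf
    obtain ⟨hcard, hle⟩ := ih hsqf' hb
    have ha0 := degree_ne_zero_of_irreducible (hirr i) ha
    have hspos := hs.card_pos
    rw [Finset.card_cons]
    refine ⟨by omega, ?_⟩
    have h1 : (projSing (G i)).encard ≤ ((a - 1).choose 2 : ℕ) :=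
      encard_le_of_forall_finset fun t ht => card_le_of_irreducible (hirr i) ha ht
    have h2 : {Q : ℙ k (Fin 3 → k) | eval Q.rep (G i) = 0 ∧
        eval Q.rep (∏ j ∈ s, G j) = 0}.encard ≤ (a * b : ℕ) :=
      encard_le_of_forall_finset fun t ht => by
        simpa using card_add_card_le_mul ha hb (left_ne_zero_of_mul hne)
          (right_ne_zero_of_mul hne) hrel (Finset.empty_subset t) (fun P hP => ht hP) (by simp)
    have harith := choose_pred_add ha0 (show b ≠ 0 by omega) (s.card - 1)
    rw [Nat.sub_add_cancel hspos] at harith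
    rw [Nat.add_sub_cancel, ← harith]
    push_cast at h1 h2 hle ⊢
    calc _ ≤ _ := Set.encard_le_encard (projSing_mul_subset ha hb ha0)
      _ ≤ _ := Set.encard_union_le _ _
      _ ≤ _ := add_le_add ((Set.encard_union_le _ _).trans (add_le_add h1 hle)) h2

end SingularPoints

end MvPolynomial

/-- A squarefree plane curve of degree d ≥ 1 with r irreducible factors has at
most binom(d−1,2) + (r−1) singular points; in particular a reduced plane curve of degree d
has at most binom(d,2) singular points. -/
theorem statement9 (k : Type) [Field k] [IsAlgClosed k] [CharZero k]
    (d : ℕ) (hd : 1 ≤ d) (F : MvPolynomial (Fin 3) k)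
    (hhom : F.IsHomogeneous d) (hsqf : Squarefree F)
    (r : ℕ) (G : Fin r → MvPolynomial (Fin 3) k)
    (hirr : ∀ i, Irreducible (G i)) (hfac : F = ∏ i, G i) :
    {Q : Projectivization k (Fin 3 → k) | ∀ i : Fin 3, eval Q.rep (pderiv i F) = 0}.Finite ∧
    {Q : Projectivization k (Fin 3 → k) | ∀ i : Fin 3, eval Q.rep (pderiv i F) = 0}.ncard ≤
      Nat.choose (d - 1) 2 + (r - 1) ∧
    {Q : Projectivization k (Fin 3 → k) | ∀ i : Fin 3, eval Q.rep (pderiv i F) = 0}.ncard ≤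
      Nat.choose d 2 := by
  subst hfac
  have hne : (Finset.univ : Finset (Fin r)).Nonempty := by
    by_contra h
    rw [Finset.not_nonempty_iff_eq_empty] at h
    rw [h, Finset.prod_empty] at hhom
    have := hhom.inj_right (isHomogeneous_one _ _) one_ne_zero
    omega
  obtain ⟨hrd, hle⟩ := encard_projSing_prod_le G hirr hne hsqf hhom
  rw [Finset.card_univ, Fintype.card_fin] at hrd hle
  obtain ⟨hfin, hcard⟩ := Set.encard_le_coe_iff_finite_ncard_le.1 hle
  refine ⟨hfin, hcard, hcard.trans ?_⟩
  obtain ⟨d, rfl⟩ := Nat.exists_eq_add_of_le' hd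
  rw [Nat.add_sub_cancel, Nat.choose_succ_succ' d 1, Nat.choose_one_right]
  change _ ≤ d + d.choose 2
  omega
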